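/- arXiv:2305.11286 — 4 statements merged into one kernel-verified Lean document; each statement's English description precedes it below -/
import Mathlib

section
/- Let n ≥ 2 be a natural number, let 1 ≤ k ≤ n, and let u ≥ 0 be real. Define c : {0,…,n-1} → ℝ by c(i) = (i/n)·u for 0 ≤ i < k and c(j) = ((j-n)/n)·u for k ≤ j < n. Then for all a, b ∈ {0,…,n-1}, |c(a) − c(b)| ≤ ((n-1)/n)·u, and there exist a, b ∈ {0,…,n-1} with |c(a) − c(b)| = ((n-1)/n)·u. -/
theorem stmt_3 (n k : ℕ) (hn : 2 ≤ n) (hk1 : 1 ≤ k) (hkn : k ≤ n)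
    (u : ℝ) (hu : 0 ≤ u)
    (c : ℕ → ℝ)
    (hc1 : ∀ i, i < k → c i = ((i : ℝ) / n) * u)
    (hc2 : ∀ j, k ≤ j → j < n → c j = (((j : ℝ) - n) / n) * u) :
    (∀ a b, a < n → b < n → |c a - c b| ≤ (((n : ℝ) - 1) / n) * u) ∧
      ∃ a b, a < n ∧ b < n ∧ |c a - c b| = (((n : ℝ) - 1) / n) * u := by
  have hk1R : (1 : ℝ) ≤ k := by exact_mod_cast hk1
  have hknR : (k : ℝ) ≤ n := by exact_mod_cast hkn
  have hsplit : (((n : ℝ) - 1) / n) * u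
      = (((k : ℝ) - 1) / n) * u - (((k : ℝ) - n) / n) * u := by ring
  have hbounds : ∀ a, a < n →
      (((k : ℝ) - n) / n) * u ≤ c a ∧ c a ≤ (((k : ℝ) - 1) / n) * u := by
    intro a ha
    have haR : (a : ℝ) + 1 ≤ n := by exact_mod_cast ha
    have ha0 : (0 : ℝ) ≤ a := a.cast_nonneg
    rcases lt_or_ge a k with h | h
    · have hR : (a : ℝ) + 1 ≤ k := by exact_mod_cast h
      rw [hc1 a h]
      constructor <;> gcongr ?_ / _ * _ <;> linarith
    · have hR : (k : ℝ) ≤ a := by exact_mod_cast h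
      rw [hc2 a h ha]
      constructor <;> gcongr ?_ / _ * _ <;> linarith
  have hmax : c (k - 1) = (((k : ℝ) - 1) / n) * u := by
    rw [hc1 (k - 1) (by omega), Nat.cast_sub hk1, Nat.cast_one]
  have hmin : ∃ b, b < n ∧ c b = (((k : ℝ) - n) / n) * u := by
    rcases hkn.lt_or_eq with h | h
    · exact ⟨k, h, hc2 k le_rfl h⟩
    · exact ⟨0, by omega, by simp [hc1 0 (by omega), h]⟩
  refine ⟨fun a b ha hb => ?_, ?_⟩
  · obtain ⟨ha1, ha2⟩ := hbounds a ha
    obtain ⟨hb1, hb2⟩ := hbounds b hb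
    rw [abs_le]
    constructor <;> linarith
  · obtain ⟨b, hb, hcb⟩ := hmin
    refine ⟨k - 1, b, by omega, hb, ?_⟩
    rw [hmax, hcb, ← hsplit, abs_of_nonneg]
    exact mul_nonneg (div_nonneg (by linarith) (by linarith)) hu
end

section
/- Let d and u be real numbers with 0 ≤ u ≤ d, let Q = min((3d+2u)/5, d/2+u), and let T be real with 0 ≤ T < Q. Let n ≥ 2 be a natural number with T < d/2 + ((n-2)/n)·u. Then there exists a real number X satisfying all of: 0 ≤ X, T + Q − (d+u) < X, X < d − T, X < 2d + u − 2Q − T, and X ≤ ((n-2)/n)·u. -/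
theorem stmt_4 (d u : ℝ) (hu : 0 ≤ u) (hud : u ≤ d)
    (Q : ℝ) (hQ : Q = min ((3 * d + 2 * u) / 5) (d / 2 + u))
    (T : ℝ) (hT0 : 0 ≤ T) (hTQ : T < Q)
    (n : ℕ) (hn : 2 ≤ n) (hTn : T < d / 2 + (((n : ℝ) - 2) / n) * u) :
    ∃ X : ℝ, 0 ≤ X ∧ T + Q - (d + u) < X ∧ X < d - T ∧
      X < 2 * d + u - 2 * Q - T ∧ X ≤ (((n : ℝ) - 2) / n) * u := by
  have hn' : (2 : ℝ) ≤ n := by exact_mod_cast hn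
  have hc : 0 ≤ (((n : ℝ) - 2) / n) * u :=
    mul_nonneg (div_nonneg (by linarith) (by linarith)) hu
  have hQ₁ : Q ≤ (3 * d + 2 * u) / 5 := hQ ▸ min_le_left _ _
  have hQ₂ : Q ≤ d / 2 + u := hQ ▸ min_le_right _ _
  generalize (((n : ℝ) - 2) / n) * u = c at *
  rcases lt_or_ge (T + Q - (d + u)) 0 with hneg | hnonneg
  · exact ⟨0, le_rfl, hneg, by linarith, by linarith, hc⟩
  · obtain ⟨X, hLX, hX⟩ := exists_between
      (show T + Q - (d + u) < min (min (d - T) (2 * d + u - 2 * Q - T)) c from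
        lt_min (lt_min (by linarith) (by linarith)) (by linarith))
    obtain ⟨hX', hXc⟩ := lt_min_iff.mp hX
    obtain ⟨hX₁, hX₂⟩ := lt_min_iff.mp hX'
    exact ⟨X, hnonneg.trans hLX.le, hLX, hX₁, hX₂, hXc.le⟩
end

section
/- Let d and u be real numbers with 0 ≤ u ≤ d, let Q = min((3d+2u)/5, d/2+u), let T be real with 0 ≤ T < Q, and let s = max(0, Q − u). Then for every natural number k ≥ 4, (k−2)·(d−u) + d > (k−1)·s + T. -/
theorem stmt_10 (d u : ℝ) (hu : 0 ≤ u) (hud : u ≤ d)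
    (Q : ℝ) (hQ : Q = min ((3 * d + 2 * u) / 5) (d / 2 + u))
    (T : ℝ) (hT0 : 0 ≤ T) (hTQ : T < Q)
    (s : ℝ) (hs : s = max 0 (Q - u)) :
    ∀ k : ℕ, 4 ≤ k → ((k : ℝ) - 2) * (d - u) + d > ((k : ℝ) - 1) * s + T := by
  intro k hk
  have hk' : (4 : ℝ) ≤ k := by exact_mod_cast hk
  have hQle : Q ≤ (3 * d + 2 * u) / 5 := hQ ▸ min_le_left _ _
  have hsle : s ≤ 3 / 5 * (d - u) := by
    rw [hs]
    exact max_le (by linarith) (by linarith)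
  have hmul : ((k : ℝ) - 1) * s ≤ ((k : ℝ) - 1) * (3 / 5 * (d - u)) :=
    mul_le_mul_of_nonneg_left hsle (by linarith)
  have hgap : 0 ≤ ((k : ℝ) - 4) * (d - u) := mul_nonneg (by linarith) (by linarith)
  linarith
end

section
/- Let d and u be real numbers with 0 ≤ u ≤ d, let Q = min((3d+2u)/5, d/2+u), let T be real with 0 ≤ T < Q, and let s = max(0, Q − u). Then for every natural number k ≥ 4, (k−1)·(d−u) + d > (k−2)·s + T. -/
theorem stmt_11 (d u : ℝ) (hu : 0 ≤ u) (hud : u ≤ d)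
    (Q : ℝ) (hQ : Q = min ((3 * d + 2 * u) / 5) (d / 2 + u))
    (T : ℝ) (hT0 : 0 ≤ T) (hTQ : T < Q)
    (s : ℝ) (hs : s = max 0 (Q - u)) :
    ∀ k : ℕ, 4 ≤ k → ((k : ℝ) - 1) * (d - u) + d > ((k : ℝ) - 2) * s + T := by
  intro k hk
  have hk' : (4 : ℝ) ≤ k := by exact_mod_cast hk
  have hQd : Q ≤ (3 * d + 2 * u) / 5 := hQ ▸ min_le_left _ _
  have hsd : s ≤ d - u := hs ▸ max_le (by linarith) (by linarith)
  have hmul : ((k : ℝ) - 2) * s ≤ ((k : ℝ) - 2) * (d - u) :=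
    mul_le_mul_of_nonneg_left hsd (by linarith)
  linarith
end
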